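/- The number of non-crossing spanning trees on n+1 points labeled 0,…,n (with the non-crossing condition that no two edges {a,b},{c,d} satisfy a < c < b < d) equals (1/(2n+1)) * binomial(3n, n). -/

import Mathlib

/-- Two vertices are adjacent if they form an edge of `E` (in either order). -/
def NCAdj (E : Finset (ℕ × ℕ)) (x y : ℕ) : Prop := (x, y) ∈ E ∨ (y, x) ∈ E

/-- Connectivity via edges of `E`. -/
def NCConn (E : Finset (ℕ × ℕ)) (x y : ℕ) : Prop :=
  Relation.ReflTransGen (NCAdj E) x y

/-- A non-crossing spanning tree on the points `0, 1, …, n`: a set of `n` edges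
`(a,b)` with `a < b ≤ n`, no two of which cross (`a < c < b < d`), connecting
all of `{0,…,n}`. -/
def IsNCST (n : ℕ) (E : Finset (ℕ × ℕ)) : Prop :=
  E.card = n ∧ (∀ e ∈ E, e.1 < e.2 ∧ e.2 ≤ n) ∧
  (∀ a b c d : ℕ, (a, b) ∈ E → (c, d) ∈ E → a < c → c < b → b < d → False) ∧
  (∀ x, x ≤ n → NCConn E 0 x)

namespace NCProof

theorem conn_symm {E : Finset (ℕ × ℕ)} {x y : ℕ} (h : NCConn E x y) : NCConn E y x := by
  induction h with
  | refl => exact Relation.ReflTransGen.refl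
  | tail _ hbc ih => exact Relation.ReflTransGen.head hbc.symm ih

theorem conn_trans {E : Finset (ℕ × ℕ)} {x y z : ℕ} (h : NCConn E x y) (h' : NCConn E y z) :
    NCConn E x z := Relation.ReflTransGen.trans h h'

theorem conn_mono {E F : Finset (ℕ × ℕ)} (hEF : E ⊆ F) {x y : ℕ} (h : NCConn E x y) :
    NCConn F x y := by
  refine Relation.ReflTransGen.mono (r := NCAdj E) ?_ _ _ h
  rintro a b (h | h)
  · exact Or.inl (hEF h)
  · exact Or.inr (hEF h)

theorem conn_edge {E : Finset (ℕ × ℕ)} {x y : ℕ} (h : (x, y) ∈ E) : NCConn E x y :=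
  Relation.ReflTransGen.single (Or.inl h)

/-- A path out of a set uses an edge leaving the set. -/
theorem exists_leaving {E : Finset (ℕ × ℕ)} {x y : ℕ} (h : NCConn E x y) (P : ℕ → Prop)
    (hx : P x) (hy : ¬ P y) : ∃ u v, NCAdj E u v ∧ P u ∧ ¬ P v := by
  induction h with
  | refl => exact absurd hx hy
  | @tail b c _ hbc ih =>
    by_cases hb : P b
    · exact ⟨b, c, hbc, hb, hy⟩
    · exact ih hb

/-- Non-crossing spanning tree on `[l,r]`. -/
def IsT (l r : ℕ) (E : Finset (ℕ × ℕ)) : Prop :=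
  E.card = r - l ∧ (∀ a b, (a, b) ∈ E → l ≤ a ∧ a < b ∧ b ≤ r) ∧
  (∀ a b c d : ℕ, (a, b) ∈ E → (c, d) ∈ E → a < c → c < b → b < d → False) ∧
  (∀ x, l ≤ x → x ≤ r → NCConn E l x)

theorem card_ge {E : Finset (ℕ × ℕ)} {l r ρ : ℕ} (h1 : l ≤ ρ) (h2 : ρ ≤ r)
    (hb : ∀ a b, (a, b) ∈ E → l ≤ a ∧ a < b ∧ b ≤ r)
    (hc : ∀ x, l ≤ x → x ≤ r → NCConn E ρ x) : r - l ≤ E.card := by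
  have key : ∀ j, j ≤ r - l → ∃ (S : Finset ℕ) (F : Finset (ℕ × ℕ)), S ⊆ Finset.Icc l r ∧
      ρ ∈ S ∧ S.card = j + 1 ∧ F ⊆ E ∧ F.card = j ∧ ∀ a b, (a, b) ∈ F → a ∈ S ∧ b ∈ S := by
    intro j
    induction j with
    | zero =>
      intro _
      exact ⟨{ρ}, ∅, by simp [h1, h2], by simp, by simp, by simp, by simp, by simp⟩
    | succ j ih =>
      intro hj
      obtain ⟨S, F, hS, hρ, hSc, hF, hFc, hFS⟩ := ih (by omega)
      have : ∃ x ∈ Finset.Icc l r, x ∉ S := by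
        apply Finset.exists_mem_notMem_of_card_lt_card
        rw [Nat.card_Icc]; omega
      obtain ⟨x, hx, hxS⟩ := this
      rw [Finset.mem_Icc] at hx
      obtain ⟨u, v, huv, hu, hv⟩ := exists_leaving (hc x hx.1 hx.2) (· ∈ S) hρ hxS
      have hvI : v ∈ Finset.Icc l r := by
        rw [Finset.mem_Icc]
        rcases huv with h | h <;> have := hb _ _ h <;> omega
      have : ∃ a b, (a, b) ∈ E ∧ (a, b) ∉ F ∧ a ∈ insert v S ∧ b ∈ insert v S := by
        rcases huv with h | h
        · exact ⟨u, v, h, fun h' => hv (hFS _ _ h').2, by simp [hu], by simp⟩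
        · exact ⟨v, u, h, fun h' => hv (hFS _ _ h').1, by simp, by simp [hu]⟩
      obtain ⟨a, b, hab, habF, ha, hb'⟩ := this
      refine ⟨insert v S, insert (a, b) F, Finset.insert_subset hvI hS, by simp [hρ], ?_,
        Finset.insert_subset hab hF, ?_, ?_⟩
      · rw [Finset.card_insert_of_notMem hv, hSc]
      · rw [Finset.card_insert_of_notMem habF, hFc]
      · intro c d hcd
        rw [Finset.mem_insert] at hcd
        rcases hcd with h | h
        · simp only [Prod.mk.injEq] at h
          rw [h.1, h.2]; exact ⟨ha, hb'⟩
        · have := hFS _ _ h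
          exact ⟨Finset.mem_insert_of_mem this.1, Finset.mem_insert_of_mem this.2⟩
  obtain ⟨S, F, _, _, _, hF, hFc, _⟩ := key (r - l) le_rfl
  rw [← hFc]; exact Finset.card_le_card hF

/-- Gluing. -/
def glue (l m : ℕ) (A B C : Finset (ℕ × ℕ)) : Finset (ℕ × ℕ) := insert (l, m) (A ∪ (B ∪ C))

theorem mem_glue {l m a b : ℕ} {A B C : Finset (ℕ × ℕ)} :
    (a, b) ∈ glue l m A B C ↔ (a = l ∧ b = m) ∨ (a, b) ∈ A ∨ (a, b) ∈ B ∨ (a, b) ∈ C := by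
  simp [glue]

theorem glue_card {l k m r : ℕ} {A B C : Finset (ℕ × ℕ)} (hlk : l ≤ k) (hkm : k < m)
    (hA : ∀ a b, (a, b) ∈ A → l ≤ a ∧ a < b ∧ b ≤ k)
    (hB : ∀ a b, (a, b) ∈ B → k + 1 ≤ a ∧ a < b ∧ b ≤ m)
    (hC : ∀ a b, (a, b) ∈ C → m ≤ a ∧ a < b ∧ b ≤ r) :
    (glue l m A B C).card = A.card + B.card + C.card + 1 := by
  unfold glue
  rw [Finset.card_insert_of_notMem, Finset.card_union_of_disjoint, Finset.card_union_of_disjoint]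
  · omega
  · rw [Finset.disjoint_left]
    rintro ⟨a, b⟩ h1 h2
    have := hB _ _ h1; have := hC _ _ h2; omega
  · rw [Finset.disjoint_left]
    rintro ⟨a, b⟩ h1 h2
    rw [Finset.mem_union] at h2
    have := hA _ _ h1
    rcases h2 with h2 | h2
    · have := hB _ _ h2; omega
    · have := hC _ _ h2; omega
  · simp only [Finset.mem_union]
    rintro (h | h | h)
    · have := hA _ _ h; omega
    · have := hB _ _ h; omega
    · have := hC _ _ h; omega

theorem glue_isT {l k m r : ℕ} {A B C : Finset (ℕ × ℕ)} (hlk : l ≤ k) (hkm : k < m) (hmr : m ≤ r)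
    (hA : IsT l k A) (hB : IsT (k + 1) m B) (hC : IsT m r C) : IsT l r (glue l m A B C) := by
  obtain ⟨a1, a2, a3, a4⟩ := hA
  obtain ⟨b1, b2, b3, b4⟩ := hB
  obtain ⟨c1, c2, c3, c4⟩ := hC
  have sA : A ⊆ glue l m A B C := by rintro ⟨a, b⟩ h; rw [mem_glue]; tauto
  have sB : B ⊆ glue l m A B C := by rintro ⟨a, b⟩ h; rw [mem_glue]; tauto
  have sC : C ⊆ glue l m A B C := by rintro ⟨a, b⟩ h; rw [mem_glue]; tauto
  have hlm : NCConn (glue l m A B C) l m := conn_edge (by rw [mem_glue]; tauto)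
  refine ⟨?_, ?_, ?_, ?_⟩
  · rw [glue_card hlk hkm a2 b2 c2]; omega
  · intro a b h
    rw [mem_glue] at h
    rcases h with h | h | h | h
    · omega
    · have := a2 _ _ h; omega
    · have := b2 _ _ h; omega
    · have := c2 _ _ h; omega
  · intro a b c d h h' x1 x2 x3
    rw [mem_glue] at h h'
    rcases h with h | h | h | h <;> rcases h' with h' | h' | h' | h'
    · omega
    · have := a2 _ _ h'; omega
    · have := b2 _ _ h'; omega
    · have := c2 _ _ h'; omega
    · have := a2 _ _ h; omega
    · exact a3 _ _ _ _ h h' x1 x2 x3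
    · have := a2 _ _ h; have := b2 _ _ h'; omega
    · have := a2 _ _ h; have := c2 _ _ h'; omega
    · have := b2 _ _ h; omega
    · have := b2 _ _ h; have := a2 _ _ h'; omega
    · exact b3 _ _ _ _ h h' x1 x2 x3
    · have := b2 _ _ h; have := c2 _ _ h'; omega
    · have := c2 _ _ h; omega
    · have := c2 _ _ h; have := a2 _ _ h'; omega
    · have := c2 _ _ h; have := b2 _ _ h'; omega
    · exact c3 _ _ _ _ h h' x1 x2 x3
  · intro x hx hxr
    by_cases h1 : x ≤ k
    · exact conn_mono sA (a4 x hx h1)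
    by_cases h2 : x ≤ m
    · have p1 := conn_mono sB (b4 x (by omega) h2)
      have p2 := conn_mono sB (b4 m (by omega) le_rfl)
      exact conn_trans hlm (conn_trans (conn_symm p2) p1)
    · exact conn_trans hlm (conn_mono sC (c4 x (by omega) hxr))

theorem glue_inj_m {l k m r k' m' : ℕ} {A B C A' B' C' : Finset (ℕ × ℕ)}
    (hlk : l ≤ k) (hkm : k < m) (hlk' : l ≤ k') (hkm' : k' < m') 
    (hA' : IsT l k' A') (hB' : IsT (k' + 1) m' B') (hC' : IsT m' r C')
    (h : glue l m A B C = glue l m' A' B' C') : m ≤ m' := by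
  have : (l, m) ∈ glue l m' A' B' C' := by rw [← h, mem_glue]; tauto
  rw [mem_glue] at this
  rcases this with h | h | h | h
  · omega
  · have := hA'.2.1 _ _ h; omega
  · have := hB'.2.1 _ _ h; omega
  · have := hC'.2.1 _ _ h; omega

theorem glue_inj_k {l k m r k' : ℕ} {A B C A' B' C' : Finset (ℕ × ℕ)}
    (hlk : l ≤ k) (hkm : k < m) (hlk' : l ≤ k') (hkm' : k' < m) 
    (hA : IsT l k A) (hB : IsT (k + 1) m B) (hC : IsT m r C) (hA' : IsT l k' A')
    (h : glue l m A B C = glue l m A' B' C') : k' ≤ k := by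
  by_contra hk
  have p := hA'.2.2.2 (k + 1) (by omega) (by omega)
  obtain ⟨u, v, huv, hu, hv⟩ := exists_leaving p (· ≤ k) hlk (by omega)
  have : ∃ a b, (a, b) ∈ A' ∧ a ≤ k ∧ k < b := by
    rcases huv with h | h
    · exact ⟨u, v, h, hu, by omega⟩
    · have := hA'.2.1 _ _ h; omega
  obtain ⟨a, b, hab, ha, hb⟩ := this
  have hab2 := hA'.2.1 _ _ hab
  have : (a, b) ∈ glue l m A B C := by rw [h, mem_glue]; tauto
  rw [mem_glue] at this
  rcases this with h | h | h | h
  · omega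
  · have := hA.2.1 _ _ h; omega
  · have := hB.2.1 _ _ h; omega
  · have := hC.2.1 _ _ h; omega

theorem glue_inj_ABC {l k m r : ℕ} {A B C A' B' C' : Finset (ℕ × ℕ)}
    (hlk : l ≤ k) (hkm : k < m)
    (hA : IsT l k A) (hB : IsT (k + 1) m B) (hC : IsT m r C)
    (hA' : IsT l k A') (hB' : IsT (k + 1) m B') (hC' : IsT m r C')
    (h : glue l m A B C = glue l m A' B' C') : A ⊆ A' ∧ B ⊆ B' ∧ C ⊆ C' := by
  refine ⟨?_, ?_, ?_⟩ <;> rintro ⟨a, b⟩ hab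
  · have h0 := hA.2.1 _ _ hab
    have : (a, b) ∈ glue l m A' B' C' := by rw [← h, mem_glue]; tauto
    rw [mem_glue] at this
    rcases this with h | h | h | h
    · omega
    · exact h
    · have := hB'.2.1 _ _ h; omega
    · have := hC'.2.1 _ _ h; omega
  · have h0 := hB.2.1 _ _ hab
    have : (a, b) ∈ glue l m A' B' C' := by rw [← h, mem_glue]; tauto
    rw [mem_glue] at this
    rcases this with h | h | h | h
    · omega
    · have := hA'.2.1 _ _ h; omega
    · exact h
    · have := hC'.2.1 _ _ h; omega
  · have h0 := hC.2.1 _ _ hab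
    have : (a, b) ∈ glue l m A' B' C' := by rw [← h, mem_glue]; tauto
    rw [mem_glue] at this
    rcases this with h | h | h | h
    · omega
    · have := hA'.2.1 _ _ h; omega
    · have := hB'.2.1 _ _ h; omega
    · exact h

/-- If every gap of `[l,m]` is covered, then `l` and `m` are connected. -/
theorem chain {D : Finset (ℕ × ℕ)} {l m : ℕ} (hlm : l ≤ m)
    (hb : ∀ a b, (a, b) ∈ D → l ≤ a ∧ a < b ∧ b ≤ m)
    (hn : ∀ a b c d : ℕ, (a, b) ∈ D → (c, d) ∈ D → a < c → c < b → b < d → False)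
    (hg : ∀ k, l ≤ k → k < m → ∃ a b, (a, b) ∈ D ∧ a ≤ k ∧ k < b) : NCConn D l m := by
  -- strong statement: a cut point `x` reaches `m`
  have key : ∀ j x, m - x = j → l ≤ x → x ≤ m →
      (∀ a b, (a, b) ∈ D → a < x → b ≤ x) → NCConn D x m := by
    intro j
    induction j using Nat.strong_induction_on with
    | _ j ih =>
      intro x hj hlx hxm hcut
      rcases Nat.eq_or_lt_of_le hxm with h | h
      · rw [h]; exact Relation.ReflTransGen.refl
      obtain ⟨a, b, hab, ha, hb'⟩ := hg x hlx h
      have hax : a = x := by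
        by_contra hne
        have := hcut a b hab (by omega); omega
      subst hax
      -- the largest neighbour
      have hne : (D.filter (fun e => e.1 = a)).Nonempty := ⟨(a, b), by simp [hab]⟩
      obtain ⟨⟨a', y⟩, hy, hmax⟩ := Finset.exists_max_image _ (fun e : ℕ × ℕ => e.2) hne
      simp only [Finset.mem_filter] at hy
      obtain ⟨hy, rfl⟩ := hy
      have hby := hb _ _ hy
      refine conn_trans (conn_edge hy) (ih (m - y) (by omega) y rfl (by omega) (by omega) ?_)
      intro c d hcd hcy
      by_contra hdy
      rcases lt_trichotomy c a' with h1 | h1 | h1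
      · have := hcut c d hcd h1; omega
      · subst h1
        have := hmax (c, d) (by simp [hcd])
        simp only at this; omega
      · exact hn _ _ _ _ hy hcd h1 hcy (by omega)
  refine key _ l rfl le_rfl hlm ?_
  intro a b hab h
  have := hb _ _ hab; omega

theorem exists_glue {l r : ℕ} {E : Finset (ℕ × ℕ)} (hlr : l < r) (hE : IsT l r E) :
    ∃ k m A B C, l ≤ k ∧ k < m ∧ m ≤ r ∧ IsT l k A ∧ IsT (k + 1) m B ∧ IsT m r C ∧
      glue l m A B C = E := by
  obtain ⟨e1, e2, e3, e4⟩ := hE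
  have hne : (E.filter (fun e => e.1 = l)).Nonempty := by
    obtain ⟨u, v, huv, hu, hv⟩ := exists_leaving (e4 r hlr.le le_rfl) (· = l) rfl (by omega)
    subst hu
    rcases huv with h | h
    · exact ⟨(u, v), by simp [h]⟩
    · have := e2 _ _ h; omega
  obtain ⟨⟨l', m⟩, hm, hmax⟩ := Finset.exists_max_image _ (fun e : ℕ × ℕ => e.2) hne
  simp only [Finset.mem_filter] at hm
  obtain ⟨hm, rfl⟩ := hm
  rename' l' => l
  have hm2 := e2 _ _ hm
  have hmax' : ∀ b, (l, b) ∈ E → b ≤ m := fun b h => hmax (l, b) (by simp [h])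
  have hsplit : ∀ a b, (a, b) ∈ E → b ≤ m ∨ m ≤ a := by
    intro a b hab
    by_contra hcon
    push Not at hcon
    have := e2 _ _ hab
    rcases Nat.eq_or_lt_of_le this.1 with h | h
    · subst h; have := hmax' _ hab; omega
    · exact e3 _ _ _ _ hm hab h hcon.2 hcon.1
  -- an uncovered gap
  have hgap : ∃ k, l ≤ k ∧ k < m ∧ ∀ a b, (a, b) ∈ E → (a, b) ≠ (l, m) → b ≤ m →
      a ≤ k → b ≤ k := by
    by_contra hcon
    push Not at hcon
    have hc := chain (D := (E.erase (l, m)).filter (fun e => e.2 ≤ m)) (l := l) (m := m)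
      hm2.2.1.le
      (by
        intro a b h
        simp only [Finset.mem_filter, Finset.mem_erase] at h
        have := e2 _ _ h.1.2; omega)
      (by
        intro a b c d h h'
        simp only [Finset.mem_filter, Finset.mem_erase] at h h'
        exact e3 _ _ _ _ h.1.2 h'.1.2)
      (by
        intro k h1 h2
        obtain ⟨a, b, h3, h4, h5, h6, h7⟩ := hcon k h1 h2
        exact ⟨a, b, by simp only [Finset.mem_filter, Finset.mem_erase]; exact ⟨⟨h4, h3⟩, h5⟩,
          h6, h7⟩)
    have hc' : NCConn (E.erase (l, m)) l m := conn_mono (Finset.filter_subset _ _) hc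
    have := card_ge (E := E.erase (l, m)) (l := l) (r := r) (ρ := l) le_rfl hlr.le
      (fun a b h => e2 a b (Finset.mem_of_mem_erase h))
      (by
        intro x h1 h2
        have hp := e4 x h1 h2
        clear h1 h2
        induction hp with
        | refl => exact Relation.ReflTransGen.refl
        | @tail y z _ hyz ih =>
          rcases hyz with h | h
          · by_cases heq : (y, z) = (l, m)
            · simp only [Prod.mk.injEq] at heq
              rw [heq.2]; exact hc'
            · exact ih.tail (Or.inl (Finset.mem_erase.2 ⟨heq, h⟩))
          · by_cases heq : (z, y) = (l, m)
            · simp only [Prod.mk.injEq] at heq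
              rw [heq.1]; exact Relation.ReflTransGen.refl
            · exact ih.tail (Or.inr (Finset.mem_erase.2 ⟨heq, h⟩)))
    rw [Finset.card_erase_of_mem hm] at this
    omega
  obtain ⟨k, hlk, hkm, hk⟩ := hgap
  set A := E.filter (fun e => e.2 ≤ k) with hAdef
  set B := E.filter (fun e => k + 1 ≤ e.1 ∧ e.2 ≤ m) with hBdef
  set C := E.filter (fun e => m ≤ e.1) with hCdef
  have mA : ∀ a b, (a, b) ∈ A ↔ (a, b) ∈ E ∧ b ≤ k := by simp [hAdef]
  have mB : ∀ a b, (a, b) ∈ B ↔ (a, b) ∈ E ∧ k + 1 ≤ a ∧ b ≤ m := by simp [hBdef]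
  have mC : ∀ a b, (a, b) ∈ C ↔ (a, b) ∈ E ∧ m ≤ a := by simp [hCdef]
  have hcov : ∀ a b, (a, b) ∈ E → (a = l ∧ b = m) ∨ (a, b) ∈ A ∨ (a, b) ∈ B ∨ (a, b) ∈ C := by
    intro a b h
    rw [mA, mB, mC]
    by_cases heq : (a, b) = (l, m)
    · left; simpa using heq
    · right
      rcases hsplit _ _ h with h1 | h1
      · by_cases h2 : a ≤ k
        · exact Or.inl ⟨h, hk _ _ h heq h1 h2⟩
        · exact Or.inr (Or.inl ⟨h, by omega, h1⟩)
      · exact Or.inr (Or.inr ⟨h, h1⟩)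
  have hglue : glue l m A B C = E := by
    ext ⟨a, b⟩
    rw [mem_glue]
    constructor
    · rintro (⟨rfl, rfl⟩ | h | h | h)
      · exact hm
      · exact ((mA _ _).1 h).1
      · exact ((mB _ _).1 h).1
      · exact ((mC _ _).1 h).1
    · exact hcov a b
  have bA : ∀ a b, (a, b) ∈ A → l ≤ a ∧ a < b ∧ b ≤ k := by
    intro a b h; rw [mA] at h; have := e2 _ _ h.1; omega
  have bB : ∀ a b, (a, b) ∈ B → k + 1 ≤ a ∧ a < b ∧ b ≤ m := by
    intro a b h; rw [mB] at h; have := e2 _ _ h.1; omega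
  have bC : ∀ a b, (a, b) ∈ C → m ≤ a ∧ a < b ∧ b ≤ r := by
    intro a b h; rw [mC] at h; have := e2 _ _ h.1; omega
  have hcov' : ∀ y z, NCAdj E y z → (y = l ∧ z = m) ∨ (y = m ∧ z = l) ∨
      (NCAdj A y z ∧ y ≤ k ∧ z ≤ k) ∨
      (NCAdj B y z ∧ k + 1 ≤ y ∧ y ≤ m ∧ k + 1 ≤ z ∧ z ≤ m) ∨
      (NCAdj C y z ∧ m ≤ y ∧ m ≤ z) := by
    intro y z h
    rcases h with h | h
    · rcases hcov _ _ h with h | h | h | h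
      · exact Or.inl h
      · have := bA _ _ h
        exact Or.inr (Or.inr (Or.inl ⟨Or.inl h, by omega, by omega⟩))
      · have := bB _ _ h
        exact Or.inr (Or.inr (Or.inr (Or.inl ⟨Or.inl h, by omega, by omega, by omega, by omega⟩)))
      · have := bC _ _ h
        exact Or.inr (Or.inr (Or.inr (Or.inr ⟨Or.inl h, by omega, by omega⟩)))
    · rcases hcov _ _ h with h | h | h | h
      · exact Or.inr (Or.inl ⟨h.2, h.1⟩)
      · have := bA _ _ h
        exact Or.inr (Or.inr (Or.inl ⟨Or.inr h, by omega, by omega⟩))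
      · have := bB _ _ h
        exact Or.inr (Or.inr (Or.inr (Or.inl ⟨Or.inr h, by omega, by omega, by omega, by omega⟩)))
      · have := bC _ _ h
        exact Or.inr (Or.inr (Or.inr (Or.inr ⟨Or.inr h, by omega, by omega⟩)))
  have hconn : ∀ x, NCConn E l x → (x ≤ k → NCConn A l x) ∧
      (k + 1 ≤ x → x ≤ m → NCConn B m x) ∧ (m ≤ x → NCConn C m x) := by
    intro x hx
    induction hx with
    | refl => exact ⟨fun _ => Relation.ReflTransGen.refl, fun h => by omega, fun h => by omega⟩
    | @tail y z _ hyz ih =>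
      obtain ⟨i1, i2, i3⟩ := ih
      rcases hcov' _ _ hyz with ⟨rfl, rfl⟩ | ⟨rfl, rfl⟩ | ⟨h, h1, h2⟩ | ⟨h, h1, h2, h3, h4⟩ |
        ⟨h, h1, h2⟩
      · exact ⟨fun h => by omega, fun _ _ => Relation.ReflTransGen.refl,
          fun _ => Relation.ReflTransGen.refl⟩
      · exact ⟨fun _ => Relation.ReflTransGen.refl, fun h => by omega, fun h => by omega⟩
      · exact ⟨fun _ => (i1 h1).tail h, fun h => by omega, fun h => by omega⟩
      · refine ⟨fun h => by omega, fun _ _ => (i2 h1 h2).tail h, fun h5 => ?_⟩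
        have : z = m := by omega
        rw [this]; exact Relation.ReflTransGen.refl
      · refine ⟨fun h => by omega, fun _ h5 => ?_, fun _ => (i3 h1).tail h⟩
        have : z = m := by omega
        rw [this]; exact Relation.ReflTransGen.refl
  have cA : ∀ x, l ≤ x → x ≤ k → NCConn A l x := fun x h1 h2 =>
    (hconn x (e4 x h1 (by omega))).1 h2
  have cB : ∀ x, k + 1 ≤ x → x ≤ m → NCConn B m x := fun x h1 h2 =>
    (hconn x (e4 x (by omega) (by omega))).2.1 h1 h2
  have cC : ∀ x, m ≤ x → x ≤ r → NCConn C m x := fun x h1 h2 =>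
    (hconn x (e4 x (by omega) (by omega))).2.2 h1
  have nA := card_ge le_rfl hlk bA cA
  have nB := card_ge (by omega) le_rfl bB cB
  have nC := card_ge le_rfl (by omega) bC cC
  have hcard := glue_card hlk hkm bA bB bC
  rw [hglue] at hcard
  refine ⟨k, m, A, B, C, hlk, hkm, by omega, ⟨by omega, bA, ?_, cA⟩, ⟨by omega, bB, ?_, ?_⟩,
    ⟨by omega, bC, ?_, cC⟩, hglue⟩
  · intro a b c d h h'
    exact e3 _ _ _ _ ((mA _ _).1 h).1 ((mA _ _).1 h').1
  · intro a b c d h h'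
    exact e3 _ _ _ _ ((mB _ _).1 h).1 ((mB _ _).1 h').1
  · intro x h1 h2
    exact conn_trans (conn_symm (cB (k + 1) le_rfl (by omega))) (cB x h1 h2)
  · intro a b c d h h'
    exact e3 _ _ _ _ ((mC _ _).1 h).1 ((mC _ _).1 h').1

open Classical in
/-- The finset of trees on `[l,r]`. -/
noncomputable def trees (l r : ℕ) : Finset (Finset (ℕ × ℕ)) :=
  ((Finset.Icc l r ×ˢ Finset.Icc l r).powerset).filter (fun E => IsT l r E)

theorem mem_trees {l r : ℕ} {E : Finset (ℕ × ℕ)} : E ∈ trees l r ↔ IsT l r E := by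
  classical
  unfold trees
  rw [Finset.mem_filter, Finset.mem_powerset]
  refine ⟨fun h => h.2, fun h => ⟨?_, h⟩⟩
  rintro ⟨a, b⟩ hab
  have := h.2.1 _ _ hab
  simp only [Finset.mem_product, Finset.mem_Icc]
  omega

theorem trees_rec (l n : ℕ) : (trees l (l + (n + 1))).card =
    ∑ p ∈ Finset.HasAntidiagonal.antidiagonal n, ∑ q ∈ Finset.HasAntidiagonal.antidiagonal p.2,
      (trees l (l + p.1)).card * ((trees (l + p.1 + 1) (l + p.1 + 1 + q.1)).card *
        (trees (l + p.1 + 1 + q.1) (l + p.1 + 1 + q.1 + q.2)).card) := by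
  have : ∀ p : ℕ × ℕ, ∀ q : ℕ × ℕ,
      (trees l (l + p.1)).card * ((trees (l + p.1 + 1) (l + p.1 + 1 + q.1)).card *
        (trees (l + p.1 + 1 + q.1) (l + p.1 + 1 + q.1 + q.2)).card) =
      (trees l (l + p.1) ×ˢ (trees (l + p.1 + 1) (l + p.1 + 1 + q.1) ×ˢ
        trees (l + p.1 + 1 + q.1) (l + p.1 + 1 + q.1 + q.2))).card := by
    intro p q; simp only [Finset.card_product]
  simp only [this]
  simp only [← Finset.card_sigma]
  symm
  refine Finset.card_bij (fun x _ => glue l (l + x.1.1 + 1 + x.2.1.1) x.2.2.1 x.2.2.2.1 x.2.2.2.2)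
    ?_ ?_ ?_
  · rintro ⟨⟨p1, p2⟩, ⟨q1, q2⟩, A, B, C⟩ h
    simp only [Finset.mem_sigma, Finset.HasAntidiagonal.mem_antidiagonal, Finset.mem_product, mem_trees] at h ⊢
    obtain ⟨h1, h2, hA, hB, hC⟩ := h
    have hr : l + p1 + 1 + q1 + q2 = l + (n + 1) := by omega
    rw [hr] at hC
    exact glue_isT (by omega) (by omega) (by omega) hA hB hC
  · rintro ⟨⟨p1, p2⟩, ⟨q1, q2⟩, A, B, C⟩ h ⟨⟨p1', p2'⟩, ⟨q1', q2'⟩, A', B', C'⟩ h' heq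
    simp only [Finset.mem_sigma, Finset.HasAntidiagonal.mem_antidiagonal, Finset.mem_product, mem_trees] at h h' heq
    obtain ⟨h1, h2, hA, hB, hC⟩ := h
    obtain ⟨h1', h2', hA', hB', hC'⟩ := h'
    have m1 := glue_inj_m (by omega) (by omega) (by omega) (by omega) hA' hB' hC' heq
      (k := l + p1)
    have m2 := glue_inj_m (by omega) (by omega) (by omega) (by omega) hA hB hC heq.symm
      (k := l + p1')
    have hm : l + p1' + 1 + q1' = l + p1 + 1 + q1 := le_antisymm m2 m1
    rw [hm] at heq hB' hC'
    have k1 := glue_inj_k (by omega) (by omega) (by omega) (by omega) hA hB hC hA' heq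
    have k2 := glue_inj_k (by omega) (by omega) (by omega) (by omega) hA' hB' hC' hA heq.symm
    have e1 : p1' = p1 := by omega
    have e2 : p2' = p2 := by omega
    have e3 : q1' = q1 := by omega
    have e4 : q2' = q2 := by omega
    subst e1 e2 e3 e4
    have s1 := glue_inj_ABC (by omega) (by omega) hA hB hC hA' hB' hC' heq
    have s2 := glue_inj_ABC (by omega) (by omega) hA' hB' hC' hA hB hC heq.symm
    rw [s1.1.antisymm s2.1, s1.2.1.antisymm s2.2.1, s1.2.2.antisymm s2.2.2]
  · intro E hE
    rw [mem_trees] at hE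
    obtain ⟨k, m, A, B, C, h1, h2, h3, hA, hB, hC, hg⟩ := exists_glue (by omega) hE
    obtain ⟨i, rfl⟩ := Nat.exists_eq_add_of_le h1
    obtain ⟨j, rfl⟩ := Nat.exists_eq_add_of_le (Nat.succ_le_of_lt h2)
    obtain ⟨t, ht⟩ := Nat.exists_eq_add_of_le h3
    rw [Nat.succ_eq_add_one] at *
    rw [ht] at hC
    refine ⟨⟨(i, n - i), (j, t), A, B, C⟩, ?_, hg⟩
    simp only [Finset.mem_sigma, Finset.HasAntidiagonal.mem_antidiagonal, Finset.mem_product, mem_trees]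
    exact ⟨by omega, by omega, hA, hB, hC⟩

theorem trees_zero (l : ℕ) : (trees l l).card = 1 := by
  rw [Finset.card_eq_one]
  refine ⟨∅, ?_⟩
  ext E
  rw [mem_trees, Finset.mem_singleton]
  constructor
  · intro h
    have := h.1
    simpa using this
  · rintro rfl
    refine ⟨by simp, by simp, by simp, ?_⟩
    intro x h1 h2
    have : x = l := by omega
    rw [this]; exact Relation.ReflTransGen.refl

theorem trees_shift (n : ℕ) : ∀ l, (trees l (l + n)).card = (trees 0 (0 + n)).card := by
  induction n using Nat.strong_induction_on with
  | _ n ih =>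
    intro l
    cases n with
    | zero => simp only [add_zero, trees_zero]
    | succ n =>
      rw [trees_rec, trees_rec]
      refine Finset.sum_congr rfl fun p hp => Finset.sum_congr rfl fun q hq => ?_
      rw [Finset.HasAntidiagonal.mem_antidiagonal] at hp hq
      rw [ih p.1 (by omega) l, ih q.1 (by omega) (l + p.1 + 1), ih q.2 (by omega) (l + p.1 + 1 + q.1),
        ih q.1 (by omega) (0 + p.1 + 1), ih q.2 (by omega) (0 + p.1 + 1 + q.1)]

/-- The number of trees. -/
noncomputable def t (n : ℕ) : ℕ := (trees 0 (0 + n)).card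

theorem t_succ (n : ℕ) : t (n + 1) = ∑ p ∈ Finset.HasAntidiagonal.antidiagonal n,
    ∑ q ∈ Finset.HasAntidiagonal.antidiagonal p.2, t p.1 * (t q.1 * t q.2) := by
  unfold t
  rw [trees_rec]
  refine Finset.sum_congr rfl fun p hp => Finset.sum_congr rfl fun q hq => ?_
  rw [trees_shift q.1, trees_shift q.2]

/-- Generating function. -/
noncomputable def T : PowerSeries ℕ := PowerSeries.mk t

theorem T_eq : T = 1 + PowerSeries.X * T ^ 3 := by
  ext n
  cases n with
  | zero => simp [T, t, trees_zero]
  | succ n =>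
    rw [map_add, PowerSeries.coeff_succ_X_mul, show T ^ 3 = T * (T * T) by ring,
      PowerSeries.coeff_mul]
    simp only [PowerSeries.coeff_mul, T, PowerSeries.coeff_mk, t_succ, Finset.mul_sum]
    simp [PowerSeries.coeff_one]

theorem coeff_T (n : ℕ) : ∀ r, (3 * n + r) * PowerSeries.coeff n (T ^ r) =
    r * Nat.choose (3 * n + r) n := by
  induction n with
  | zero =>
    intro r
    have : PowerSeries.constantCoeff T = 1 := by simp [T, t, trees_zero]
    simp [this]
  | succ n ihn =>
    intro r
    induction r with
    | zero => simp [PowerSeries.coeff_one]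
    | succ r ihr =>
      have h : T ^ (r + 1) = T ^ r + PowerSeries.X * T ^ (r + 3) := by
        calc T ^ (r + 1) = T ^ r * T := pow_succ _ _
          _ = T ^ r * (1 + PowerSeries.X * T ^ 3) := by rw [← T_eq]
          _ = _ := by ring
      rw [h, map_add, PowerSeries.coeff_succ_X_mul]
      have h1 := ihn (r + 3)
      set u := PowerSeries.coeff (n + 1) (T ^ r)
      set v := PowerSeries.coeff n (T ^ (r + 3))
      rw [show 3 * (n + 1) + (r + 1) = (3 * n + r + 3) + 1 by ring, Nat.choose_succ_succ]
      rw [show 3 * (n + 1) + r = 3 * n + r + 3 by ring] at ihr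
      rw [show 3 * n + (r + 3) = 3 * n + r + 3 by ring] at h1
      have h2 := Nat.choose_succ_right_eq (3 * n + r + 3) n
      rw [show 3 * n + r + 3 - n = 2 * n + r + 3 by omega] at h2
      set c := Nat.choose (3 * n + r + 3) n
      set d := Nat.choose (3 * n + r + 3) (n + 1)
      have hpos : 0 < 3 * n + r + 3 := by omega
      apply Nat.eq_of_mul_eq_mul_left hpos
      zify at *
      have e : (3 * (n:ℤ) + r + 3) * ((3 * n + r + 3 + 1) * (u + v)) =
        (3 * n + r + 4) * (r * d + (r + 3) * c) := by
        linear_combination (3 * (n:ℤ) + r + 4) * (ihr + h1)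
      linear_combination e - 3 * h2

theorem isNCST_iff (n : ℕ) (E : Finset (ℕ × ℕ)) : IsNCST n E ↔ IsT 0 (0 + n) E := by
  unfold IsNCST IsT
  constructor
  · rintro ⟨h1, h2, h3, h4⟩
    refine ⟨by omega, ?_, h3, fun x _ h => h4 x (by omega)⟩
    intro a b hab
    have := h2 _ hab
    simp only at this; omega
  · rintro ⟨h1, h2, h3, h4⟩
    refine ⟨by omega, ?_, h3, fun x h => h4 x (by omega) (by omega)⟩
    rintro ⟨a, b⟩ hab
    have := h2 _ _ hab
    simp only; omega

end NCProof

/-- The number of non-crossing spanning trees on `n+1` points labeled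
`0,…,n` is `(1/(2n+1)) * choose (3n) n`, stated multiplicatively. -/
theorem card_ncst (n : ℕ) :
    (2 * n + 1) * Set.ncard {E : Finset (ℕ × ℕ) | IsNCST n E} =
      Nat.choose (3 * n) n := by
  have h : {E : Finset (ℕ × ℕ) | IsNCST n E} = ↑(NCProof.trees 0 (0 + n)) := by
    ext E
    rw [Set.mem_ofPred_eq, NCProof.isNCST_iff, Finset.mem_coe, NCProof.mem_trees]
  rw [h, Set.ncard_coe_finset]
  have h1 := NCProof.coeff_T n 1
  rw [pow_one, NCProof.T, PowerSeries.coeff_mk, NCProof.t, one_mul] at h1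
  have h2 := Nat.add_one_mul_choose_eq (3 * n) n
  have h3 := Nat.choose_mul_succ_eq (3 * n) n
  rw [show 3 * n + 1 - n = 2 * n + 1 by omega, ← h1] at h3
  have hpos : 0 < 3 * n + 1 := by omega
  apply Nat.eq_of_mul_eq_mul_left hpos
  linarith
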